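/- arXiv:2207.05576 — 4 statements merged into one kernel-verified Lean document; each statement's English description precedes it below -/
import Mathlib

section
/- For every integer r ≥ 3 and every integer d, there exists a finite family F of r-graphs such that the Turán density π(F) is an algebraic real number whose minimal polynomial over ℚ has degree at least d. -/
/-- `H` is an `r`-graph on vertex set `Fin n`: every edge is an `r`-element subset. -/
def IsRGraph (r n : ℕ) (H : Finset (Finset (Fin n))) : Prop :=
  ∀ e ∈ H, e.card = r

/-- `G` (on `Fin a`) appears as a subgraph of `H` (on `Fin n`): there is an injection of
vertices mapping every edge of `G` to an edge of `H`. -/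
def ContainsCopy {a n : ℕ} (G : Finset (Finset (Fin a))) (H : Finset (Finset (Fin n))) : Prop :=
  ∃ f : Fin a → Fin n, Function.Injective f ∧ ∀ e ∈ G, e.image f ∈ H

/-- `H` is `F`-free: no member of the family `F` appears as a subgraph of `H`. -/
def IsFree {n : ℕ} (F : Finset ((a : ℕ) × Finset (Finset (Fin a))))
    (H : Finset (Finset (Fin n))) : Prop :=
  ∀ G ∈ F, ¬ ContainsCopy G.2 H

/-- The Turán number `ex(n, F)`: the maximum number of edges of an `F`-free `r`-graph
on `n` vertices. -/
noncomputable def exTuran (r : ℕ) (F : Finset ((a : ℕ) × Finset (Finset (Fin a))))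
    (n : ℕ) : ℕ :=
  sSup {k | ∃ H : Finset (Finset (Fin n)), IsRGraph r n H ∧ IsFree F H ∧ H.card = k}

section

open Finset

/-- The Lagrangian polynomial of a hypergraph. -/
def lagrangePoly {V : Type*} (P : Finset (Finset V)) (x : V → ℝ) : ℝ :=
  ∑ e ∈ P, ∏ v ∈ e, x v

lemma sum_tuples_eq_factorial_mul_lagrangePoly {V : Type*} [Fintype V] [DecidableEq V] {r : ℕ}
    {P : Finset (Finset V)} (hP : ∀ e ∈ P, #e = r) (x : V → ℝ) :
    ∑ u : Fin r → V with univ.image u ∈ P, ∏ i, x (u i) = r.factorial * lagrangePoly P x := by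
  rw [lagrangePoly, mul_sum, ← sum_fiberwise_of_maps_to (g := fun u : Fin r → V => univ.image u)
    (t := P) (by simp)]
  refine sum_congr rfl fun e he => ?_
  let φ := e.equivFinOfCardEq (hP e he)
  have hset : ({u ∈ ({u | univ.image u ∈ P} : Finset (Fin r → V)) | univ.image u = e}) =
      univ.image (fun (σ : Equiv.Perm (Fin r)) i => (φ.symm (σ i) : V)) := by
    ext u
    simp only [mem_filter, mem_univ, true_and, mem_image]
    constructor
    · rintro ⟨-, hu⟩
      have hmem : ∀ i, u i ∈ e := fun i => hu ▸ mem_image_of_mem u (mem_univ i)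
      have hinj : Function.Injective u := by
        refine Set.injOn_univ.1 ?_
        rw [← coe_univ, ← card_image_iff, hu, hP e he, card_univ, Fintype.card_fin]
      refine ⟨Equiv.ofBijective (fun i => φ ⟨u i, hmem i⟩) ?_, ?_⟩
      · rw [← Finite.injective_iff_bijective]
        intro i j hij
        exact hinj (congrArg Subtype.val (φ.injective hij))
      · ext i; simp
    · rintro ⟨σ, rfl⟩
      have : univ.image (fun i => (φ.symm (σ i) : V)) = e := by
        ext v
        simp only [mem_image, mem_univ, true_and]
        constructor
        · rintro ⟨i, rfl⟩; exact (φ.symm (σ i)).2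
        · intro hv; exact ⟨σ.symm (φ ⟨v, hv⟩), by simp⟩
      exact ⟨by rwa [this], this⟩
  rw [hset, sum_image]
  · have : ∀ σ : Equiv.Perm (Fin r), ∏ i, x (φ.symm (σ i)) = ∏ v ∈ e, x v := by
      intro σ
      rw [Equiv.prod_comp σ (fun i => x (φ.symm i)), Equiv.prod_comp φ.symm (fun v => x v),
        prod_coe_sort e x]
    simp [this, Fintype.card_perm]
  · intro σ _ τ _ h
    ext i
    simpa [Fin.ext_iff] using congrFun h i

/-- The `r`-uniform blow-up of `P` along `f`. -/
def blowup {V : Type*} [DecidableEq V] {n : ℕ} (r : ℕ) (P : Finset (Finset V)) (f : Fin n → V) :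
    Finset (Finset (Fin n)) :=
  {e | #e = r ∧ e.image f ∈ P}

lemma card_blowup {V : Type*} [Fintype V] [DecidableEq V] {n r : ℕ} {P : Finset (Finset V)}
    (hP : ∀ e ∈ P, #e = r) (f : Fin n → V) :
    (#(blowup r P f) : ℝ) = lagrangePoly P (fun v => (#{i | f i = v} : ℝ)) := by
  refine mul_left_cancel₀ (by positivity : (r.factorial : ℝ) ≠ 0) ?_
  have hH : ∀ e ∈ blowup r P f, #e = r := by simp +contextual [blowup]
  have h1 := sum_tuples_eq_factorial_mul_lagrangePoly hH (fun _ => 1)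
  have h2 : lagrangePoly (blowup r P f) (fun _ => 1) = #(blowup r P f) := by simp [lagrangePoly]
  rw [← h2, ← h1, ← sum_tuples_eq_factorial_mul_lagrangePoly hP]
  have hset : ({v | univ.image v ∈ blowup r P f} : Finset (Fin r → Fin n)) =
      ({v | univ.image (f ∘ v) ∈ P} : Finset (Fin r → Fin n)) := by
    ext v
    simp only [blowup, mem_filter, mem_univ, true_and, image_image, and_iff_right_iff_imp]
    intro hv
    refine le_antisymm (card_image_le.trans (by simp)) ?_
    have h := card_image_le (s := univ.image v) (f := f)
    rwa [image_image, hP _ hv] at h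
  rw [hset, ← sum_fiberwise_of_maps_to (g := fun v : Fin r → Fin n => f ∘ v)
    (t := ({u | univ.image u ∈ P} : Finset (Fin r → V))) (by simp)]
  refine sum_congr rfl fun u hu => ?_
  have : ({v ∈ ({v | univ.image (f ∘ v) ∈ P} : Finset (Fin r → Fin n)) | f ∘ v = u}) =
      Fintype.piFinset fun i => ({j | f j = u i} : Finset (Fin n)) := by
    ext v
    simp only [mem_filter, mem_univ, true_and, Fintype.mem_piFinset, funext_iff,
      Function.comp_apply]
    refine ⟨fun h => h.2, fun h => ⟨?_, h⟩⟩
    have : f ∘ v = u := funext h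
    simpa [this] using hu
  rw [this]
  simp [Fintype.card_piFinset]

lemma mul_lagrangePoly_eq_of_uncovered_pair {U : Type*} [DecidableEq U] {H : Finset (Finset U)}
    {x : U → ℝ} {i j : U} (hij : i ≠ j)
    (hH : ∀ e ∈ H, i ∈ e → j ∈ e → ∃ v ∈ e, x v = 0 ∧ v ≠ i ∧ v ≠ j) :
    (x i + x j) * lagrangePoly H x =
      x i * lagrangePoly H (Function.update (Function.update x i (x i + x j)) j 0) +
      x j * lagrangePoly H (Function.update (Function.update x j (x i + x j)) i 0) := by
  simp only [lagrangePoly, mul_sum, ← sum_add_distrib]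
  refine sum_congr rfl fun e he => ?_
  have hrest : ∀ {y : U → ℝ}, (∀ v, v ≠ i → v ≠ j → y v = x v) → ∀ s : Finset U, i ∉ s → j ∉ s →
      ∏ v ∈ s, y v = ∏ v ∈ s, x v := fun hy s hi hj =>
    prod_congr rfl fun v hv => hy v (ne_of_mem_of_not_mem hv hi) (ne_of_mem_of_not_mem hv hj)
  set y := Function.update (Function.update x i (x i + x j)) j 0 with hy
  set z := Function.update (Function.update x j (x i + x j)) i 0 with hz
  have hyv : ∀ v, v ≠ i → v ≠ j → y v = x v := fun v hi hj => by simp [hy, hi, hj]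
  have hzv : ∀ v, v ≠ i → v ≠ j → z v = x v := fun v hi hj => by simp [hz, hi, hj]
  have hyi : y i = x i + x j := by simp [hy, hij]
  have hyj : y j = 0 := by simp [hy]
  have hzj : z j = x i + x j := by simp [hz, hij.symm]
  have hzi : z i = 0 := by simp [hz]
  by_cases hi : i ∈ e <;> by_cases hj : j ∈ e
  · obtain ⟨v, hv, hxv, hvi, hvj⟩ := hH e he hi hj
    rw [prod_eq_zero hv hxv, prod_eq_zero hi hzi, prod_eq_zero hj hyj]
    ring
  · rw [prod_eq_zero hi hzi, ← mul_prod_erase e x hi, ← mul_prod_erase e y hi, hyi,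
      hrest hyv (e.erase i) (by simp) (by simp [hj])]
    ring
  · rw [prod_eq_zero hj hyj, ← mul_prod_erase e x hj, ← mul_prod_erase e z hj, hzj,
      hrest hzv (e.erase j) (by simp [hi]) (by simp)]
    ring
  · rw [hrest hyv e hi hj, hrest hzv e hi hj]
    ring

lemma lagrangePoly_le_of_covered {U V : Type*} [Fintype U] [DecidableEq U] [Fintype V]
    [DecidableEq V] {r : ℕ} {H : Finset (Finset U)} {P : Finset (Finset V)} {lam : ℝ}
    (hP : ∀ e ∈ P, #e = r) (hH : ∀ e ∈ H, #e = r)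
    (hlam : ∀ y ∈ stdSimplex ℝ V, lagrangePoly P y ≤ lam)
    (hhom : ∀ W : Finset U, #W ≤ (Fintype.card V + 1) + (Fintype.card V + 1) ^ 2 * r →
      ∃ φ : U → V, ∀ e ∈ H, e ⊆ W → e.image φ ∈ P)
    {x : U → ℝ} (hx : x ∈ stdSimplex ℝ U)
    (hcov : ∀ i j, i ≠ j → x i ≠ 0 → x j ≠ 0 → ∃ e ∈ H, (∀ v ∈ e, x v ≠ 0) ∧ i ∈ e ∧ j ∈ e) :
    lagrangePoly H x ≤ lam := by
  set S : Finset U := {v | x v ≠ 0} with hS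
  have hinj : ∀ {W T : Finset U} {φ : U → V}, (∀ e ∈ H, e ⊆ W → e.image φ ∈ P) →
      (∀ i ∈ T, ∀ j ∈ T, i ≠ j → ∃ e ∈ H, e ⊆ W ∧ i ∈ e ∧ j ∈ e) → Set.InjOn φ T := by
    intro W T φ hφ hT i hi j hj hij
    by_contra hne
    obtain ⟨e, he, heW, hie, hje⟩ := hT i hi j hj hne
    have hcard : #(e.image φ) = #e := by rw [hP _ (hφ e he heW), hH e he]
    exact hne (card_image_iff.1 hcard hie hje hij)
  have hScard : #S ≤ Fintype.card V := by
    by_contra! hlt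
    obtain ⟨T, hTS, hT⟩ := exists_subset_card_eq (Nat.succ_le_of_lt hlt)
    have hc : ∀ p : U × U, ∃ e : Finset U, #e ≤ r ∧
        (p.1 ∈ T → p.2 ∈ T → p.1 ≠ p.2 → e ∈ H ∧ p.1 ∈ e ∧ p.2 ∈ e) := by
      intro p
      by_cases hp : p.1 ∈ T ∧ p.2 ∈ T ∧ p.1 ≠ p.2
      · obtain ⟨e, he, -, h1, h2⟩ := hcov p.1 p.2 hp.2.2 (by simpa [hS] using hTS hp.1)
          (by simpa [hS] using hTS hp.2.1)
        exact ⟨e, (hH e he).le, fun _ _ _ => ⟨he, h1, h2⟩⟩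
      · exact ⟨∅, by simp, fun h1 h2 h3 => absurd ⟨h1, h2, h3⟩ hp⟩
    choose c hcr hc using hc
    obtain ⟨φ, hφ⟩ := hhom (T ∪ (T ×ˢ T).biUnion c) <| by
      refine (card_union_le _ _).trans (add_le_add hT.le ?_)
      refine (card_biUnion_le_card_mul _ _ r fun p _ => hcr p).trans ?_
      rw [card_product, hT, sq]
    have hφT := hinj (T := T) hφ fun i hi j hj hij => by
      obtain ⟨h1, h2, h3⟩ := hc (i, j) hi hj hij
      exact ⟨c (i, j), h1, (subset_biUnion_of_mem c (mk_mem_product hi hj)).trans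
        subset_union_right, h2, h3⟩
    have := card_le_univ (T.image φ)
    rw [card_image_of_injOn hφT, hT] at this
    omega
  obtain ⟨φ, hφ⟩ := hhom S (by nlinarith)
  have hφS := hinj (T := S) hφ fun i hi j hj hij => by
    obtain ⟨e, he, heS, h1, h2⟩ := hcov i j hij (by simpa [hS] using hi) (by simpa [hS] using hj)
    exact ⟨e, he, fun v hv => by simpa [hS] using heS v hv, h1, h2⟩
  set y : V → ℝ := fun u => ∑ v with φ v = u, x v with hy
  have hy0 : ∀ u, 0 ≤ y u := fun u => sum_nonneg fun v _ => hx.1 v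
  have hxy : ∀ v, x v ≤ y (φ v) := fun v =>
    single_le_sum (f := x) (fun w _ => hx.1 w) (by simp)
  refine le_trans ?_ (hlam y ⟨hy0, by rw [← hx.2]; exact sum_fiberwise univ φ x⟩)
  calc lagrangePoly H x = ∑ e ∈ H with e ⊆ S, ∏ v ∈ e, x v := by
        refine (sum_filter_of_ne fun e _ hne v hv => ?_).symm
        simpa [hS] using fun h : x v = 0 => hne (prod_eq_zero hv h)
    _ ≤ ∑ e ∈ H with e ⊆ S, ∏ u ∈ e.image φ, y u := by
        refine sum_le_sum fun e he => ?_
        rw [prod_image (hφS.mono (by exact_mod_cast (mem_filter.1 he).2))]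
        exact prod_le_prod (fun v _ => hx.1 v) fun v _ => hxy v
    _ = ∑ f ∈ ({e ∈ H | e ⊆ S}).image (image φ), ∏ u ∈ f, y u := by
        rw [sum_image]
        intro e he f hf hef
        exact image_injOn_powerset_of_injOn (f := φ) hφS (by simpa using (mem_filter.1 he).2)
          (by simpa using (mem_filter.1 hf).2) hef
    _ ≤ lagrangePoly P y := by
        refine sum_le_sum_of_subset_of_nonneg ?_ fun f _ _ => prod_nonneg fun u _ => hy0 u
        intro f hf
        obtain ⟨e, he, rfl⟩ := mem_image.1 hf
        exact hφ e (mem_filter.1 he).1 (mem_filter.1 he).2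

theorem lagrangePoly_le_of_locally_hom {U V : Type*} [Fintype U] [DecidableEq U] [Fintype V]
    [DecidableEq V] {r : ℕ} {H : Finset (Finset U)} {P : Finset (Finset V)} {lam : ℝ}
    (hP : ∀ e ∈ P, #e = r) (hH : ∀ e ∈ H, #e = r)
    (hlam : ∀ y ∈ stdSimplex ℝ V, lagrangePoly P y ≤ lam)
    (hhom : ∀ W : Finset U, #W ≤ (Fintype.card V + 1) + (Fintype.card V + 1) ^ 2 * r →
      ∃ φ : U → V, ∀ e ∈ H, e ⊆ W → e.image φ ∈ P)
    {x : U → ℝ} (hx : x ∈ stdSimplex ℝ U) : lagrangePoly H x ≤ lam := by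
  induction hk : #{v | x v ≠ 0} using Nat.strong_induction_on generalizing x with
  | _ k ih =>
  by_cases hcov : ∀ i j, i ≠ j → x i ≠ 0 → x j ≠ 0 →
      ∃ e ∈ H, (∀ v ∈ e, x v ≠ 0) ∧ i ∈ e ∧ j ∈ e
  · exact lagrangePoly_le_of_covered hP hH hlam hhom hx hcov
  push Not at hcov
  obtain ⟨i, j, hij, hi, hj, hno⟩ := hcov
  have hshift : ∀ a b, a ≠ b → x a ≠ 0 → x b ≠ 0 →
      lagrangePoly H (Function.update (Function.update x a (x a + x b)) b 0) ≤ lam := by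
    intro a b hab ha hb
    set y := Function.update (Function.update x a (x a + x b)) b 0 with hy
    have hya : y a = x a + x b := by simp [hy, hab]
    have hyb : y b = 0 := by simp [hy]
    have hyv : ∀ v, v ≠ a → v ≠ b → y v = x v := fun v h1 h2 => by simp [hy, h1, h2]
    refine ih #{v | y v ≠ 0} ?_ ⟨fun v => ?_, ?_⟩ rfl
    · rw [← hk]
      refine card_lt_card ((ssubset_iff_of_subset fun v hv => ?_).2 ⟨b, by simpa, by simp [hyb]⟩)
      simp only [mem_filter, mem_univ, true_and] at hv ⊢
      rcases eq_or_ne v a with rfl | hva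
      · exact ha
      · rcases eq_or_ne v b with rfl | hvb
        · exact hb
        · rwa [hyv v hva hvb] at hv
    · rcases eq_or_ne v b with rfl | hvb
      · exact hyb.ge
      · rcases eq_or_ne v a with rfl | hva
        · rw [hya]; exact add_nonneg (hx.1 _) (hx.1 _)
        · rw [hyv v hva hvb]; exact hx.1 v
    · have h2 := hx.2
      rw [← add_sum_erase _ _ (mem_univ a), ← add_sum_erase _ _ (mem_erase.2 ⟨hab.symm, mem_univ b⟩)]
        at h2 ⊢
      rw [hya, hyb, ← h2]
      have : ∑ v ∈ (univ.erase a).erase b, y v = ∑ v ∈ (univ.erase a).erase b, x v :=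
        sum_congr rfl fun v hv => by
          simp only [mem_erase] at hv
          exact hyv v hv.2.1 hv.1
      rw [this]
      ring
  have hpi : 0 < x i := (hx.1 i).lt_of_ne' hi
  have hpj : 0 < x j := (hx.1 j).lt_of_ne' hj
  have hsplit := mul_lagrangePoly_eq_of_uncovered_pair (H := H) (x := x) hij fun e he hie hje => by
    by_contra! hne
    refine hno e he (fun v hv h0 => ?_) hie hje
    by_cases hvi : v = i
    · exact hi (hvi ▸ h0)
    · exact hj (hne v hv h0 hvi ▸ h0)
  have h1 := hshift i j hij hi hj
  have h2 := hshift j i hij.symm hj hi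
  rw [add_comm (x j)] at h2
  refine le_of_mul_le_mul_left ?_ (add_pos hpi hpj)
  rw [hsplit]
  nlinarith [mul_le_mul_of_nonneg_left h1 hpi.le, mul_le_mul_of_nonneg_left h2 hpj.le]

lemma exists_floor_mul_le_card_fiber {V : Type*} [Fintype V] [DecidableEq V] {x : V → ℝ}
    (hx : x ∈ stdSimplex ℝ V) (n : ℕ) :
    ∃ f : Fin n → V, ∀ v, ⌊x v * n⌋₊ ≤ #{i | f i = v} := by
  have hV : Nonempty V := by
    by_contra h
    rw [not_nonempty_iff] at h
    simpa using hx.2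
  have hcard : Fintype.card (Σ v, Fin ⌊x v * n⌋₊) ≤ Fintype.card (Fin n) := by
    simp only [Fintype.card_sigma, Fintype.card_fin]
    have : ((∑ v, ⌊x v * n⌋₊ : ℕ) : ℝ) ≤ n := by
      push_cast
      calc ∑ v, (⌊x v * n⌋₊ : ℝ) ≤ ∑ v, x v * n :=
            sum_le_sum fun v _ => Nat.floor_le (mul_nonneg (hx.1 v) n.cast_nonneg)
        _ = n := by rw [← sum_mul, hx.2, one_mul]
    exact_mod_cast this
  obtain ⟨g⟩ := Function.Embedding.nonempty_of_card_le hcard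
  refine ⟨Function.extend g Sigma.fst fun _ => hV.some, fun v => ?_⟩
  calc ⌊x v * n⌋₊ = #((univ : Finset (Fin ⌊x v * n⌋₊)).image fun k => g ⟨v, k⟩) := by
        rw [card_image_of_injective _ fun a b h => by simpa using h, card_univ, Fintype.card_fin]
    _ ≤ _ := card_le_card fun i hi => by
        obtain ⟨k, -, rfl⟩ := mem_image.1 hi
        simp [g.injective.extend_apply]

lemma lagrangePoly_mono {V : Type*} {P : Finset (Finset V)} {x y : V → ℝ} (hx : ∀ v, 0 ≤ x v)
    (hxy : ∀ v, x v ≤ y v) : lagrangePoly P x ≤ lagrangePoly P y :=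
  sum_le_sum fun _ _ => prod_le_prod (fun v _ => hx v) fun v _ => hxy v

lemma lagrangePoly_mul {V : Type*} {r : ℕ} {P : Finset (Finset V)} (hP : ∀ e ∈ P, #e = r)
    (c : ℝ) (x : V → ℝ) : lagrangePoly P (fun v => c * x v) = c ^ r * lagrangePoly P x := by
  rw [lagrangePoly, lagrangePoly, mul_sum]
  exact sum_congr rfl fun e he => by rw [prod_mul_distrib, prod_const, hP e he]

open Classical in
/-- All `r`-graphs on at most `N` vertices admitting no homomorphism to `P`. -/
noncomputable def nonHomFamily {V : Type*} (r N : ℕ) (P : Finset (Finset V)) :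
    Finset ((a : ℕ) × Finset (Finset (Fin a))) :=
  (range (N + 1)).sigma fun a =>
    {G | IsRGraph r a G ∧ ¬ ∃ φ : Fin a → V, ∀ e ∈ G, e.image φ ∈ P}

lemma mem_nonHomFamily {V : Type*} [DecidableEq V] {r N : ℕ} {P : Finset (Finset V)}
    {G : (a : ℕ) × Finset (Finset (Fin a))} :
    G ∈ nonHomFamily r N P ↔
      G.1 ≤ N ∧ IsRGraph r G.1 G.2 ∧ ¬ ∃ φ : Fin G.1 → V, ∀ e ∈ G.2, e.image φ ∈ P := by
  simp only [nonHomFamily, mem_sigma, mem_range, mem_filter, mem_univ, true_and, Order.lt_add_one_iff]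
  convert Iff.rfl

lemma isFree_blowup {V : Type*} [DecidableEq V] {n r N : ℕ} {P : Finset (Finset V)}
    (f : Fin n → V) : IsFree (nonHomFamily r N P) (blowup r P f) := by
  rintro ⟨a, G⟩ hG ⟨g, -, hg⟩
  refine (mem_nonHomFamily.1 hG).2.2 ⟨f ∘ g, fun e he => ?_⟩
  have := hg e he
  simp only [blowup, mem_filter] at this
  rw [← image_image]
  exact this.2.2

lemma exists_hom_of_isFree {V : Type*} [DecidableEq V] [Nonempty V] {n r N : ℕ}
    {P : Finset (Finset V)} {H : Finset (Finset (Fin n))} (hH : IsRGraph r n H)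
    (hfree : IsFree (nonHomFamily r N P) H) {W : Finset (Fin n)} (hW : #W ≤ N) :
    ∃ φ : Fin n → V, ∀ e ∈ H, e ⊆ W → e.image φ ∈ P := by
  let g : Fin #W → Fin n := fun i => W.equivFin.symm i
  have hg : Function.Injective g := Subtype.val_injective.comp W.equivFin.symm.injective
  let G : Finset (Finset (Fin #W)) := {e | e.image g ∈ H}
  have hG : (⟨#W, G⟩ : (a : ℕ) × Finset (Finset (Fin a))) ∉ nonHomFamily r N P := fun hmem =>
    hfree _ hmem ⟨g, hg, fun e he => (mem_filter.1 he).2⟩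
  rw [mem_nonHomFamily] at hG
  push Not at hG
  obtain ⟨φ, hφ⟩ := hG hW fun e he => by
    rw [← hH _ (mem_filter.1 he).2, card_image_of_injective _ hg]
  refine ⟨Function.extend g φ fun _ => Classical.arbitrary V, fun e he heW => ?_⟩
  have hpre : ({i | g i ∈ e} : Finset (Fin #W)).image g = e := by
    ext v
    simp only [mem_image, mem_filter, mem_univ, true_and]
    refine ⟨fun ⟨i, hi, hiv⟩ => hiv ▸ hi, fun hv => ?_⟩
    have hgv : g (W.equivFin ⟨v, heW hv⟩) = v := by simp [g]
    exact ⟨_, by rwa [hgv], hgv⟩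
  have hmem := hφ {i | g i ∈ e} (by simpa [G, hpre] using he)
  rw [← hpre, image_image, show Function.extend g φ (fun _ => Classical.arbitrary V) ∘ g = φ from
    funext fun i => hg.extend_apply _ _ _]
  exact hmem

lemma bddAbove_exTuran (r n : ℕ) (F : Finset ((a : ℕ) × Finset (Finset (Fin a)))) :
    BddAbove {k | ∃ H : Finset (Finset (Fin n)), IsRGraph r n H ∧ IsFree F H ∧ #H = k} :=
  ⟨Fintype.card (Finset (Fin n)), by rintro k ⟨H, -, -, rfl⟩; exact card_le_univ H⟩

/-- `lam` is the maximum over the standard simplex of the Lagrangian polynomial of some `r`-graph. -/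
def IsLagrangian (r : ℕ) (lam : ℝ) : Prop :=
  ∃ (V : Type) (_ : Fintype V) (_ : DecidableEq V) (P : Finset (Finset V)),
    (∀ e ∈ P, #e = r) ∧ (∀ x ∈ stdSimplex ℝ V, lagrangePoly P x ≤ lam) ∧
      ∃ x ∈ stdSimplex ℝ V, lagrangePoly P x = lam

/-- Every Lagrangian of an `r`-graph is, up to the factor `r!`, the Turán density of a finite
family. -/
theorem IsLagrangian.exists_tendsto_exTuran {r : ℕ} {lam : ℝ} (h : IsLagrangian r lam) :
    ∃ F : Finset ((a : ℕ) × Finset (Finset (Fin a))), (∀ G ∈ F, IsRGraph r G.1 G.2) ∧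
      Filter.Tendsto (fun n : ℕ => (exTuran r F n : ℝ) / (n.choose r : ℝ)) Filter.atTop
        (nhds (r.factorial * lam)) := by
  obtain ⟨V, _, _, P, hP, hle, x, hx, hxlam⟩ := h
  have hV : Nonempty V := by
    by_contra h
    rw [not_nonempty_iff] at h
    simpa using hx.2
  set F := nonHomFamily r ((Fintype.card V + 1) + (Fintype.card V + 1) ^ 2 * r) P with hF
  refine ⟨F, fun G hG => (mem_nonHomFamily.1 hG).2.1, ?_⟩
  have hupper : ∀ n : ℕ, 0 < n → (exTuran r F n : ℝ) / (n : ℝ) ^ r ≤ lam := by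
    intro n hn
    have hn' : (n : ℝ) ≠ 0 := by positivity
    obtain ⟨H, hH, hfree, hcard⟩ := Nat.sSup_mem
      (s := {k | ∃ H : Finset (Finset (Fin n)), IsRGraph r n H ∧ IsFree F H ∧ #H = k})
      ⟨_, blowup r P fun _ => hV.some, fun e he => (mem_filter.1 he).2.1, isFree_blowup _, rfl⟩
      (bddAbove_exTuran r n F)
    have hsimplex : (fun _ => (n : ℝ)⁻¹ * 1) ∈ stdSimplex ℝ (Fin n) :=
      ⟨fun _ => by positivity, by simp [hn']⟩
    have hmain := lagrangePoly_le_of_locally_hom hP hH hle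
      (fun W hW => exists_hom_of_isFree hH hfree hW) hsimplex
    rw [lagrangePoly_mul hH] at hmain
    rw [exTuran, ← hcard, div_eq_inv_mul, ← inv_pow]
    simpa [lagrangePoly] using hmain
  have hlower : ∀ n : ℕ, 0 < n →
      lagrangePoly P (fun v => (⌊x v * n⌋₊ : ℝ) / n) ≤ (exTuran r F n : ℝ) / (n : ℝ) ^ r := by
    intro n hn
    obtain ⟨f, hf⟩ := exists_floor_mul_le_card_fiber hx n
    have hex : #(blowup r P f) ≤ exTuran r F n := le_csSup (bddAbove_exTuran r n F)
      ⟨_, fun e he => (mem_filter.1 he).2.1, isFree_blowup f, rfl⟩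
    have hblow : lagrangePoly P (fun v => (⌊x v * n⌋₊ : ℝ)) ≤ exTuran r F n := by
      refine le_trans ?_ (Nat.cast_le.2 hex)
      rw [card_blowup hP]
      exact lagrangePoly_mono (fun v => by positivity) fun v => by exact_mod_cast hf v
    simp only [div_eq_inv_mul]
    rw [lagrangePoly_mul hP, inv_pow]
    gcongr
  have hlim : Filter.Tendsto (fun n : ℕ => lagrangePoly P (fun v => (⌊x v * n⌋₊ : ℝ) / n))
      Filter.atTop (nhds lam) := by
    rw [← hxlam]
    exact tendsto_finsetSum _ fun e _ => tendsto_finsetProd _ fun v _ =>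
      (tendsto_nat_floor_mul_div_atTop (hx.1 v)).comp tendsto_natCast_atTop_atTop
  have hpow : Filter.Tendsto (fun n : ℕ => (exTuran r F n : ℝ) / (n : ℝ) ^ r)
      Filter.atTop (nhds lam) := by
    refine tendsto_of_tendsto_of_tendsto_of_le_of_le' hlim tendsto_const_nhds ?_ ?_
    · filter_upwards [Filter.eventually_gt_atTop 0] with n hn using hlower n hn
    · filter_upwards [Filter.eventually_gt_atTop 0] with n hn using hupper n hn
  have hchoose : Filter.Tendsto (fun n : ℕ => (n : ℝ) ^ r / n.choose r) Filter.atTop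
      (nhds r.factorial) := by
    have h1 := (isEquivalent_choose r).symm
    rw [Asymptotics.isEquivalent_iff_tendsto_one] at h1
    · have h2 := h1.mul_const (r.factorial : ℝ)
      rw [one_mul] at h2
      refine h2.congr fun n => ?_
      simp only [Pi.div_apply]
      field_simp
    · filter_upwards [Filter.eventually_ge_atTop r] with n hn
      exact_mod_cast (Nat.choose_pos hn).ne'
  have hprod := hpow.mul hchoose
  rw [mul_comm lam] at hprod
  refine hprod.congr' ?_
  filter_upwards [Filter.eventually_gt_atTop 0] with n hn
  have hn' : (n : ℝ) ≠ 0 := by positivity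
  field_simp

lemma lagrangePoly_le_mul_sum_pow {V : Type*} [Fintype V] {r : ℕ} (hr : r ≠ 0)
    {P : Finset (Finset V)} {lam : ℝ} (hP : ∀ e ∈ P, #e = r)
    (hle : ∀ x ∈ stdSimplex ℝ V, lagrangePoly P x ≤ lam) {y : V → ℝ} (hy : ∀ v, 0 ≤ y v) :
    lagrangePoly P y ≤ (∑ v, y v) ^ r * lam := by
  rcases (sum_nonneg fun v _ => hy v : 0 ≤ ∑ v, y v).eq_or_lt' with h0 | hpos
  · have hy0 : y = fun v => 0 * y v := by
      funext v
      simpa using (sum_eq_zero_iff_of_nonneg fun v _ => hy v).1 h0 v (mem_univ v)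
    rw [h0, hy0, lagrangePoly_mul hP]
    simp [hr]
  · have hscale : (fun v => (∑ v, y v) * ((∑ v, y v)⁻¹ * y v)) = y := by
      funext v
      field_simp
    rw [← hscale, lagrangePoly_mul hP, hscale]
    refine mul_le_mul_of_nonneg_left (hle _ ⟨fun v => ?_, ?_⟩) (by positivity)
    · exact mul_nonneg (by positivity) (hy v)
    · rw [← mul_sum, inv_mul_cancel₀ hpos.ne']

lemma IsLagrangian.nonneg {r : ℕ} {lam : ℝ} (h : IsLagrangian r lam) : 0 ≤ lam := by
  obtain ⟨V, _, _, P, -, -, x, hx, rfl⟩ := h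
  exact sum_nonneg fun e _ => prod_nonneg fun v _ => hx.1 v

lemma isLagrangian_zero (r : ℕ) : IsLagrangian r 0 :=
  ⟨Unit, inferInstance, inferInstance, ∅, by simp, by simp [lagrangePoly], fun _ => 1,
    ⟨fun _ => zero_le_one, by simp⟩, by simp [lagrangePoly]⟩

lemma mul_pow_le_of_add_eq_one {r : ℕ} (hr : r ≠ 0) {t u : ℝ} (hu : 0 ≤ u)
    (htu : t + u = 1) : t * u ^ r ≤ r ^ r / (r + 1) ^ (r + 1) := by
  rcases hu.eq_or_lt' with rfl | hpos
  · rw [zero_pow hr, mul_zero]; positivity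
  have hr' : (0 : ℝ) < r := by positivity
  have hb := one_add_mul_le_pow (a := r / ((r + 1) * u) - 1)
    (by have : 0 ≤ r / ((r + 1) * u) := by positivity
        linarith) (r + 1)
  have h1 : 1 + ((r + 1 : ℕ) : ℝ) * (r / ((r + 1) * u) - 1) = r * t / u := by
    rw [← eq_sub_iff_add_eq] at htu
    rw [htu]
    push_cast
    field_simp
    ring
  rw [h1, add_sub_cancel, div_pow, mul_pow, div_le_div_iff₀ hpos (by positivity)] at hb
  rw [le_div_iff₀ (by positivity)]
  refine le_of_mul_le_mul_left ?_ (mul_pos hr' hpos)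
  calc r * u * (t * u ^ r * (r + 1) ^ (r + 1)) = r * t * ((r + 1) ^ (r + 1) * u ^ (r + 1)) := by
        ring
    _ ≤ r ^ (r + 1) * u := hb
    _ = r * u * r ^ r := by ring

/-- Adding a common new vertex to all edges scales the Lagrangian by a rational factor. -/
lemma IsLagrangian.cone {r : ℕ} (hr : r ≠ 0) {lam : ℝ} (h : IsLagrangian r lam) :
    IsLagrangian (r + 1) (r ^ r / (r + 1) ^ (r + 1) * lam) := by
  have hlam := h.nonneg
  obtain ⟨V, _, _, P, hP, hle, x, hx, rfl⟩ := h
  have hL : ∀ y : Option V → ℝ, lagrangePoly (P.map insertNone.toEmbedding) y =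
      y none * lagrangePoly P fun v => y (some v) := by
    intro y
    simp [lagrangePoly, mul_sum, prod_insertNone]
  have hr' : (r : ℝ) + 1 ≠ 0 := by positivity
  refine ⟨Option V, inferInstance, inferInstance, P.map insertNone.toEmbedding, ?_, ?_,
    fun o => o.elim (1 / (r + 1)) (fun v => r / (r + 1) * x v), ⟨?_, ?_⟩, ?_⟩
  · intro e he
    obtain ⟨f, hf, rfl⟩ := mem_map.1 he
    simp [card_insertNone, hP f hf]
  · intro y hy
    have hsum := hy.2
    rw [Fintype.sum_option] at hsum
    rw [hL]
    calc y none * lagrangePoly P (fun v => y (some v))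
        ≤ y none * ((∑ v, y (some v)) ^ r * lagrangePoly P x) :=
          mul_le_mul_of_nonneg_left
            (lagrangePoly_le_mul_sum_pow hr hP hle fun v => hy.1 _) (hy.1 _)
      _ = y none * (∑ v, y (some v)) ^ r * lagrangePoly P x := by ring
      _ ≤ _ := mul_le_mul_of_nonneg_right (mul_pow_le_of_add_eq_one hr
          (sum_nonneg fun v _ => hy.1 _) hsum) hlam
  · rintro (_ | v)
    · simp only [Option.elim]; positivity
    · exact mul_nonneg (by positivity) (hx.1 v)
  · rw [Fintype.sum_option]
    simp only [Option.elim, ← mul_sum, hx.2]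
    field_simp
    ring
  · rw [hL]
    simp only [Option.elim]
    rw [lagrangePoly_mul hP, div_pow, pow_succ]
    field_simp

lemma two_mul_lagrangePoly_powersetCard_two {m : ℕ} (y : Fin m → ℝ) :
    2 * lagrangePoly (powersetCard 2 univ) y = (∑ i, y i) ^ 2 - ∑ i, y i ^ 2 := by
  have h := sum_tuples_eq_factorial_mul_lagrangePoly (r := 2) (P := powersetCard 2 univ)
    (fun e he => (mem_powersetCard.1 he).2) y
  rw [Nat.factorial_two, Nat.cast_two] at h
  rw [← h, eq_sub_iff_add_eq, Fintype.sum_pow, ← sum_filter_add_sum_filter_not univ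
    (fun u : Fin 2 → Fin m => univ.image u ∈ powersetCard 2 univ)]
  congr 1
  refine sum_nbij' (fun i _ => i) (fun u => u 0) ?_ (by simp) (by simp) ?_ (by simp [sq])
  · intro i _
    have : (univ.image fun _ : Fin 2 => i) = {i} := by ext; simp [eq_comm]
    simp [mem_powersetCard, this]
  · intro u hu
    have hu' : u 0 = u 1 := by
      by_contra hne
      refine (mem_filter.1 hu).2 (mem_powersetCard.2 ⟨subset_univ _, ?_⟩)
      rw [card_image_of_injective, card_univ, Fintype.card_fin]
      intro i j hij
      fin_cases i <;> fin_cases j <;> simp_all [eq_comm]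
    funext i
    fin_cases i <;> simp [hu']

/-- Joining an `r`-graph with a complete graph on `m` vertices. -/
lemma IsLagrangian.join {lam g D : ℝ} (h : IsLagrangian 3 lam) {m : ℕ} (hm : m ≠ 0)
    (hg : g = (m - 1) / (2 * m)) (hg0 : 0 ≤ g) (hD0 : 0 ≤ D) (hD2 : 2 ≤ D ^ 2 + 2 * D)
    (hlam : lam = g * (1 - D ^ 2) / 3) :
    IsLagrangian 3 (2 / 3 * g * ((1 + D) / (2 + D) ^ 2)) := by
  obtain ⟨V, _, _, P, hP, hle, x, hx, hxlam⟩ := h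
  have hm' : (0 : ℝ) < m := by positivity
  let Q : Finset (Finset (V ⊕ Fin m)) := P.image (fun e => e.disjSum ∅) ∪
    ((univ : Finset V) ×ˢ powersetCard 2 (univ : Finset (Fin m))).image
      fun p => ({p.1} : Finset V).disjSum p.2
  have hL : ∀ y : V ⊕ Fin m → ℝ, lagrangePoly Q y = lagrangePoly P (fun v => y (Sum.inl v)) +
      (∑ v, y (Sum.inl v)) * lagrangePoly (powersetCard 2 univ) (fun i => y (Sum.inr i)) := by
    intro y
    rw [lagrangePoly, sum_union, sum_image, sum_image, sum_product, sum_mul]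
    · simp [lagrangePoly, prod_disjSum, mul_sum]
    · rintro ⟨v, q⟩ _ ⟨w, q'⟩ _ hvw
      have h1 := congrArg toLeft hvw
      have h2 := congrArg toRight hvw
      simp only [toLeft_disjSum, toRight_disjSum, singleton_inj] at h1 h2
      rw [h1, h2]
    · intro e _ f _ hef
      have h1 := congrArg toLeft hef
      rwa [toLeft_disjSum, toLeft_disjSum] at h1
    · rw [disjoint_left]
      intro e he he'
      obtain ⟨f, -, rfl⟩ := mem_image.1 he
      obtain ⟨⟨v, q⟩, hq, hvq⟩ := mem_image.1 he'
      have h2 := congrArg toRight hvq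
      simp only [toRight_disjSum] at h2
      have := (mem_powersetCard.1 (mem_product.1 hq).2).2
      simp [h2] at this
  have hbound : ∀ t s : ℝ, 0 ≤ t → 0 ≤ s → t + s = 1 →
      t ^ 3 * lam + t * (g * s ^ 2) ≤ 2 / 3 * g * ((1 + D) / (2 + D) ^ 2) := by
    intro t s ht hs hts
    obtain rfl : s = 1 - t := by linarith
    have hid : 2 / 3 * g * ((1 + D) / (2 + D) ^ 2) - (t ^ 3 * lam + t * (g * (1 - t) ^ 2)) =
        g / 3 * ((t * (2 + D) - 1) ^ 2 / (2 + D) ^ 2) * (2 + 2 * D - (4 - D ^ 2) * t) := by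
      rw [hlam]
      field_simp
      ring
    have : 0 ≤ 2 + 2 * D - (4 - D ^ 2) * t := by nlinarith
    rw [← sub_nonneg, hid]
    positivity
  refine ⟨V ⊕ Fin m, inferInstance, inferInstance, Q, ?_, ?_,
    Sum.elim (fun v => 1 / (2 + D) * x v) (fun _ => (1 + D) / (2 + D) / m), ⟨?_, ?_⟩, ?_⟩
  · intro e he
    rcases mem_union.1 he with he | he
    · obtain ⟨f, hf, rfl⟩ := mem_image.1 he
      simp [hP f hf]
    · obtain ⟨⟨v, q⟩, hq, rfl⟩ := mem_image.1 he
      simp [card_disjSum, (mem_powersetCard.1 (mem_product.1 hq).2).2]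
  · intro y hy
    have hsum := hy.2
    rw [Fintype.sum_sum_type] at hsum
    have ht : 0 ≤ ∑ v, y (Sum.inl v) := sum_nonneg fun v _ => hy.1 _
    have hs : 0 ≤ ∑ i, y (Sum.inr i) := sum_nonneg fun v _ => hy.1 _
    refine le_trans ?_ (hbound _ _ ht hs hsum)
    rw [hL]
    refine add_le_add (lagrangePoly_le_mul_sum_pow (by norm_num) hP hle fun v => hy.1 _)
      (mul_le_mul_of_nonneg_left ?_ ht)
    have h1 := two_mul_lagrangePoly_powersetCard_two fun i => y (Sum.inr i)
    have h2 := sq_sum_le_card_mul_sum_sq (s := univ) (f := fun i => y (Sum.inr i))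
    rw [card_univ, Fintype.card_fin] at h2
    rw [hg, div_mul_eq_mul_div, le_div_iff₀ (by positivity)]
    nlinarith
  · rintro (v | i)
    · exact mul_nonneg (by positivity) (hx.1 v)
    · simp only [Sum.elim_inr]; positivity
  · rw [Fintype.sum_sum_type]
    simp only [Sum.elim_inl, Sum.elim_inr, ← mul_sum, hx.2, sum_const, card_univ, Fintype.card_fin,
      nsmul_eq_mul]
    field_simp
    ring
  · have h1 := two_mul_lagrangePoly_powersetCard_two fun _ : Fin m => (1 + D) / (2 + D) / m
    simp only [sum_const, card_univ, Fintype.card_fin, nsmul_eq_mul] at h1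
    have h2 : lagrangePoly (powersetCard 2 univ) (fun _ : Fin m => (1 + D) / (2 + D) / m) =
        g * ((1 + D) / (2 + D)) ^ 2 := by
      rw [hg]
      field_simp at h1 ⊢
      linarith
    rw [hL]
    simp only [Sum.elim_inl, Sum.elim_inr, ← mul_sum, hx.2]
    rw [lagrangePoly_mul hP, hxlam, h2, hlam]
    field_simp
    ring

lemma exists_seq_isLagrangian : ∃ y : ℕ → ℝ, y 0 * (y 0 - 2) = -2 / 5 ∧
    (∀ k, y (k + 1) * (y (k + 1) - 2) = -2 * y k / (y k + 1) ^ 2) ∧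
    ∀ k, IsLagrangian 3 (5 / 18 * (y k / (y k + 1) ^ 2)) := by
  let D : ℕ → ℝ := fun k => Nat.rec √(3 / 5) (fun _ D => √(D ^ 2 + 2 * D + 2) / (D + 2)) k
  have hD0 : D 0 = √(3 / 5) := rfl
  have hDs : ∀ k, D (k + 1) = √(D k ^ 2 + 2 * D k + 2) / (D k + 2) := fun k => rfl
  have hnonneg : ∀ k, 0 ≤ D k := by
    intro k
    induction k with
    | zero => rw [hD0]; positivity
    | succ k ih => rw [hDs]; positivity
  have hsq0 : D 0 ^ 2 = 3 / 5 := by rw [hD0]; exact Real.sq_sqrt (by norm_num)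
  have hsq : ∀ k, D (k + 1) ^ 2 = (D k ^ 2 + 2 * D k + 2) / (D k + 2) ^ 2 := by
    intro k
    have := hnonneg k
    rw [hDs, div_pow, Real.sq_sqrt (by positivity)]
  have h3 : √3 ^ 2 = (3 : ℝ) := Real.sq_sqrt (by norm_num)
  have h3l : 1.732 ≤ √3 := Real.le_sqrt_of_sq_le (by norm_num)
  have hq : 0 ≤ √3 - 1 := by linarith
  have hge : ∀ k, √3 - 1 ≤ D k := by
    intro k
    induction k with
    | zero =>
      refine (pow_le_pow_iff_left₀ hq (hnonneg 0) two_ne_zero).1 ?_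
      rw [hsq0]
      nlinarith
    | succ k ih =>
      refine (pow_le_pow_iff_left₀ hq (hnonneg (k + 1)) two_ne_zero).1 ?_
      rw [hsq, le_div_iff₀ (by have := hnonneg k; positivity)]
      have hfactor : 0 ≤ (D k - (√3 - 1)) * ((2 * √3 - 3) * D k + (3 * √3 - 5)) :=
        mul_nonneg (sub_nonneg.2 ih)
          (add_nonneg (mul_nonneg (by linarith) (hnonneg k)) (by linarith))
      linear_combination hfactor + (D k ^ 2 + 2 * D k + 1) * h3
  have hinv : ∀ k, 2 ≤ D k ^ 2 + 2 * D k := fun k => by nlinarith [hge k]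
  have hmain : ∀ k, IsLagrangian 3 (5 / 12 * (1 - D k ^ 2) / 3) := by
    intro k
    induction k with
    | zero =>
      have := (isLagrangian_zero 3).join (m := 4) (g := 3 / 8) (D := 1) (by norm_num) (by norm_num)
        (by norm_num) (by norm_num) (by norm_num) (by norm_num)
      rw [hsq0]
      convert this using 1
      norm_num
    | succ k ih =>
      have := ih.join (m := 6) (by norm_num) (by norm_num) (by norm_num) (hnonneg k)
        (hinv k) rfl
      have h0 := hnonneg k
      convert this using 1
      rw [hsq]
      field_simp
      ring
  refine ⟨fun k => D k + 1, ?_, fun k => ?_, fun k => ?_⟩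
  · linear_combination hsq0
  · have h0 := hnonneg k
    have h1 := hsq k
    calc (D (k + 1) + 1) * (D (k + 1) + 1 - 2) = D (k + 1) ^ 2 - 1 := by ring
      _ = _ := by
        rw [h1]
        field_simp
        ring
  · have h0 := hnonneg k
    have h1 := hmain (k + 1)
    rw [hsq] at h1
    convert h1 using 1
    field_simp
    ring

lemma IsLagrangian.exists_rat_mul {lam : ℝ} (h : IsLagrangian 3 lam) (j : ℕ) :
    ∃ q : ℚ, q ≠ 0 ∧ IsLagrangian (j + 3) (q * lam) := by
  induction j with
  | zero => exact ⟨1, one_ne_zero, by simpa using h⟩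
  | succ j ih =>
    obtain ⟨q, hq, hL⟩ := ih
    refine ⟨((j + 3 : ℕ) : ℚ) ^ (j + 3) / ((j + 3 : ℕ) + 1) ^ (j + 3 + 1) * q,
      mul_ne_zero (by positivity) hq, ?_⟩
    have := hL.cone (by omega)
    rw [show j + 1 + 3 = j + 3 + 1 by ring]
    convert this using 1
    push_cast
    ring

open Polynomial in
/-- If some power `‖x‖ ^ (2 ^ k)` is an odd power of `2`, then `x` has degree at least `2 ^ k`. -/
lemma two_pow_le_natDegree_of_norm_pow_eq {x : PadicAlgCl 2} {k : ℕ} {s : ℤ} (hs : Odd s)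
    (hx : ‖x‖ ^ (2 ^ k) = (2 : ℝ) ^ s) {p : ℚ[X]} (hp : p ≠ 0)
    (hpx : p.eval₂ (Rat.castHom (PadicAlgCl 2)) x = 0) : 2 ^ k ≤ p.natDegree := by
  have hrat : ∀ q : ℚ, q ≠ 0 → ∃ z : ℤ, ‖(q : PadicAlgCl 2)‖ = (2 : ℝ) ^ z := by
    intro q hq
    refine ⟨-(q : ℚ_[2]).valuation, ?_⟩
    have h := PadicAlgCl.norm_extends 2 (q : ℚ_[2])
    rw [map_ratCast] at h
    rw [h, Padic.norm_eq_zpow_neg_valuation (by exact_mod_cast hq)]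
    norm_num
  have hx0 : 0 < ‖x‖ := by
    refine (norm_nonneg x).lt_of_ne fun h => ?_
    rw [← h, zero_pow (by positivity)] at hx
    exact absurd hx (by positivity)
  set f : ℕ → PadicAlgCl 2 := fun i => (p.coeff i : PadicAlgCl 2) * x ^ i with hf
  have hsum : ∑ i ∈ p.support, f i = 0 := by
    simpa [Polynomial.eval₂_eq_sum, Polynomial.sum_def] using hpx
  have hpos : ∀ i ∈ p.support, 0 < ‖f i‖ := by
    intro i hi
    have hi' : (p.coeff i : PadicAlgCl 2) ≠ 0 := by
      exact_mod_cast Polynomial.mem_support_iff.1 hi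
    rw [hf, norm_mul, norm_pow]
    exact mul_pos (norm_pos_iff.2 hi') (pow_pos hx0 _)
  obtain ⟨j, hj, hmax⟩ := p.support.exists_max_image (fun i => ‖f i‖)
    (Polynomial.support_nonempty.2 hp)
  obtain ⟨i, hi, hij, heq⟩ : ∃ i ∈ p.support, i ≠ j ∧ ‖f i‖ = ‖f j‖ := by
    by_contra! hne
    have h := Valuation.map_sum_eq_of_lt (v := (Valued.v : Valuation (PadicAlgCl 2) NNReal))
      (s := p.support) (f := f) hj ?_
    · rw [hsum, map_zero] at h
      have h' := hpos j hj
      rw [← PadicAlgCl.valuation_coe, ← h] at h'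
      simp at h'
    · intro i hi
      simp only [Finset.mem_sdiff, Finset.mem_singleton] at hi
      rw [← NNReal.coe_lt_coe, PadicAlgCl.valuation_coe, PadicAlgCl.valuation_coe]
      exact lt_of_le_of_ne (hmax i hi.1) (hne i hi.1 hi.2)
  obtain ⟨a, ha⟩ := hrat _ (Polynomial.mem_support_iff.1 hi)
  obtain ⟨b, hb⟩ := hrat _ (Polynomial.mem_support_iff.1 hj)
  simp only [hf, norm_mul, norm_pow, ha, hb] at heq
  have hexp : a * 2 ^ k + s * i = b * 2 ^ k + s * j := by
    have h := congrArg (· ^ (2 ^ k)) heq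
    simp only [mul_pow, ← pow_mul] at h
    rw [mul_comm i, mul_comm j, pow_mul, pow_mul, hx] at h
    simp only [← zpow_natCast, ← zpow_mul] at h
    rw [← zpow_add₀ (by norm_num), ← zpow_add₀ (by norm_num)] at h
    have := zpow_right_injective₀ (by norm_num : (0 : ℝ) < 2) (by norm_num) h
    exact_mod_cast this
  have hdvd : ((2 : ℤ) ^ k) ∣ ((i : ℤ) - j) := by
    have hc : IsCoprime ((2 : ℤ) ^ k) s :=
      IsCoprime.pow_left ((Int.isCoprime_iff_gcd_eq_one).2 (by
        rw [← Int.isCoprime_iff_gcd_eq_one]; exact (Int.isCoprime_two_left).2 hs))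
    exact hc.dvd_of_dvd_mul_left ⟨b - a, by linear_combination hexp⟩
  have hle := Int.le_of_dvd (abs_pos.2 (by omega)) ((dvd_abs _ _).2 hdvd)
  have h1 := Polynomial.le_natDegree_of_mem_supp i hi
  have h2 := Polynomial.le_natDegree_of_mem_supp j hj
  have h3 : |(i : ℤ) - j| ≤ p.natDegree := by rw [abs_le]; omega
  exact_mod_cast hle.trans h3

lemma norm_two_padicAlgCl : ‖(2 : PadicAlgCl 2)‖ = 1 / 2 := by
  have := PadicAlgCl.valuation_p 2
  rw [← PadicAlgCl.valuation_coe]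
  simpa using congrArg NNReal.toReal this

lemma norm_sq_eq_of_mul_sub_two {x : PadicAlgCl 2} (h : 1 / 4 < ‖x * (x - 2)‖) :
    ‖x‖ ^ 2 = ‖x * (x - 2)‖ := by
  have h2 := norm_two_padicAlgCl
  have hx : 1 / 2 < ‖x‖ := by
    by_contra! hx
    have : ‖x - 2‖ ≤ 1 / 2 :=
      by
      rw [sub_eq_add_neg]
      exact (IsUltrametricDist.norm_add_le_max x (-2)).trans (max_le hx (by rw [norm_neg, h2]))
    rw [norm_mul] at h
    nlinarith [norm_nonneg x, norm_nonneg (x - 2)]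
  have : ‖x - 2‖ = ‖x‖ := by
    rw [sub_eq_add_neg, IsUltrametricDist.norm_add_eq_max_of_norm_ne_norm
      (by rw [norm_neg, h2]; exact hx.ne'), norm_neg, h2]
    exact max_eq_left hx.le
  rw [norm_mul, this, sq]

lemma norm_seq_pow {z : ℕ → PadicAlgCl 2} (h0 : z 0 * (z 0 - 2) = -2 / 5)
    (hz : ∀ k, z (k + 1) * (z (k + 1) - 2) = -2 * z k / (z k + 1) ^ 2) (k : ℕ) :
    ‖z k‖ < 1 ∧ ‖z k‖ ^ (2 ^ (k + 1)) = (2 : ℝ) ^ (1 - 2 ^ (k + 1) : ℤ) := by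
  have h2 := norm_two_padicAlgCl
  have h5 : ‖(5 : PadicAlgCl 2)‖ = 1 := by
    have h4 : ‖(4 : PadicAlgCl 2)‖ = 1 / 4 := by
      rw [show (4 : PadicAlgCl 2) = 2 * 2 by norm_num, norm_mul, h2]; norm_num
    rw [show (5 : PadicAlgCl 2) = 4 + 1 by norm_num,
      IsUltrametricDist.norm_add_eq_max_of_norm_ne_norm] <;> rw [h4, norm_one] <;> norm_num
  induction k with
  | zero =>
    have hn : ‖z 0 * (z 0 - 2)‖ = 1 / 2 := by rw [h0, norm_div, norm_neg, h2, h5]; norm_num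
    have hs := norm_sq_eq_of_mul_sub_two (x := z 0) (by rw [hn]; norm_num)
    rw [hn] at hs
    refine ⟨by nlinarith [norm_nonneg (z 0)], ?_⟩
    norm_num [hs]
  | succ k ih =>
    obtain ⟨hlt, hpow⟩ := ih
    have h1 : ‖z k + 1‖ = 1 := by
      rw [IsUltrametricDist.norm_add_eq_max_of_norm_ne_norm (by rw [norm_one]; exact hlt.ne),
        norm_one]
      exact max_eq_right hlt.le
    have hn : ‖z (k + 1) * (z (k + 1) - 2)‖ = ‖z k‖ / 2 := by
      rw [hz, norm_div, norm_mul, norm_neg, h2, norm_pow, h1]; ring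
    have hgt : 1 / 2 < ‖z k‖ := by
      by_contra! hle
      have := pow_le_pow_left₀ (norm_nonneg (z k)) hle (2 ^ (k + 1))
      rw [hpow, one_div, inv_pow, ← zpow_natCast, ← zpow_neg,
        zpow_le_zpow_iff_right₀ (by norm_num)] at this
      push_cast at this
      omega
    have hs := norm_sq_eq_of_mul_sub_two (x := z (k + 1)) (by rw [hn]; linarith)
    rw [hn] at hs
    refine ⟨by nlinarith [norm_nonneg (z (k + 1))], ?_⟩
    rw [pow_succ' 2 (k + 1), pow_mul, hs, div_pow, hpow, ← zpow_natCast (2 : ℝ),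
      ← zpow_sub₀ (by norm_num)]
    congr 1
    push_cast
    ring

/-- Iterating `y ↦ y'`, where `y' (y' - 2) = -2 y / (y + 1) ^ 2`, produces numbers whose degree
grows exponentially, because the `2`-adic value group ramifies at every step. -/
theorem isAlgebraic_and_le_natDegree_of_seq {y : ℕ → ℝ} (h0 : y 0 * (y 0 - 2) = -2 / 5)
    (hy : ∀ k, y (k + 1) * (y (k + 1) - 2) = -2 * y k / (y k + 1) ^ 2) {q : ℚ} (hq : q ≠ 0)
    (k : ℕ) :
    IsAlgebraic ℚ (q * (y k / (y k + 1) ^ 2)) ∧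
      2 ^ (k + 1) ≤ (minpoly ℚ (q * (y k / (y k + 1) ^ 2))).natDegree := by
  have hsq : ∀ {t c : ℝ}, t * (t - 2) = c → IsAlgebraic ℚ c → IsAlgebraic ℚ t := by
    intro t c htc hc
    have h1 : IsAlgebraic ℚ ((t - 1) ^ 2) := by
      rw [show (t - 1) ^ 2 = c + 1 by rw [← htc]; ring]
      exact hc.add isAlgebraic_one
    simpa using (h1.of_pow two_pos).add isAlgebraic_one
  have hrat : ∀ q : ℚ, IsAlgebraic ℚ (q : ℝ) := fun q => isAlgebraic_algebraMap q
  have hfrac : ∀ j, IsAlgebraic ℚ (y j) → IsAlgebraic ℚ (y j / (y j + 1) ^ 2) := fun j hj => by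
    rw [div_eq_mul_inv]
    exact hj.mul ((hj.add isAlgebraic_one).pow 2).inv
  have halg : ∀ j, IsAlgebraic ℚ (y j) := by
    intro j
    induction j with
    | zero => exact hsq h0 (by simpa using hrat (-2 / 5))
    | succ j ih =>
      refine hsq (hy j) ?_
      rw [mul_div_assoc]
      exact (by simpa using hrat (-2) : IsAlgebraic ℚ (-2 : ℝ)).mul (hfrac j ih)
  refine ⟨(hrat q).mul (hfrac k (halg k)), ?_⟩
  let A := algebraicClosure ℚ ℝ
  let Y : ℕ → A := fun j => ⟨y j, mem_algebraicClosure_iff.2 (halg j)⟩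
  have hA : Algebra.IsAlgebraic ℚ A := algebraicClosure.isAlgebraic ℚ ℝ
  let σ : A →+* PadicAlgCl 2 := (IsAlgClosed.lift : A →ₐ[ℚ] PadicAlgCl 2).toRingHom
  have hY0 : Y 0 * (Y 0 - 2) = -2 / 5 := Subtype.ext h0
  have hYs : ∀ j, Y (j + 1) * (Y (j + 1) - 2) = -2 * Y j / (Y j + 1) ^ 2 :=
    fun j => Subtype.ext (hy j)
  have hσ2 : σ 2 = 2 := map_ofNat σ 2
  have hσ5 : σ 5 = 5 := map_ofNat σ 5
  obtain ⟨hlt, hpow⟩ := norm_seq_pow (z := fun j => σ (Y j))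
    (by simpa [hσ2, hσ5] using congrArg σ hY0)
    (fun j => by simpa [hσ2] using congrArg σ (hYs j)) k
  have h1 : ‖σ (Y k) + 1‖ = 1 := by
    rw [IsUltrametricDist.norm_add_eq_max_of_norm_ne_norm (by rw [norm_one]; exact hlt.ne),
      norm_one]
    exact max_eq_right hlt.le
  set B : A := (q : A) * (Y k / (Y k + 1) ^ 2) with hB
  have hBcoe : (algebraMap A ℝ) B = q * (y k / (y k + 1) ^ 2) := rfl
  have hmin : minpoly ℚ (q * (y k / (y k + 1) ^ 2)) = minpoly ℚ B := by
    rw [← hBcoe]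
    exact minpoly.algebraMap_eq (algebraMap A ℝ).injective B
  have hBint : IsIntegral ℚ B := Algebra.IsIntegral.isIntegral B
  have hval : σ B = q * (σ (Y k) / (σ (Y k) + 1) ^ 2) := by simp [hB]
  have hqn : ‖(q : PadicAlgCl 2)‖ = (2 : ℝ) ^ (-(q : ℚ_[2]).valuation) := by
    have h := PadicAlgCl.norm_extends 2 (q : ℚ_[2])
    rw [map_ratCast] at h
    rw [h, Padic.norm_eq_zpow_neg_valuation (by exact_mod_cast hq)]
    norm_num
  rw [hmin]
  refine two_pow_le_natDegree_of_norm_pow_eq (x := σ B)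
    (s := -(q : ℚ_[2]).valuation * 2 ^ (k + 1) + (1 - 2 ^ (k + 1))) ?_ ?_
    (minpoly.ne_zero hBint) ?_
  · rw [pow_succ]
    exact ⟨-(q : ℚ_[2]).valuation * 2 ^ k - 2 ^ k, by ring⟩
  · rw [hval, norm_mul, norm_div, norm_pow, h1, one_pow, div_one, mul_pow, hpow, hqn,
      zpow_add₀ (by norm_num), zpow_mul]
    norm_cast
  · have h := congrArg σ (minpoly.aeval ℚ B)
    rw [map_zero, Polynomial.aeval_def, Polynomial.hom_eval₂] at h
    rwa [Subsingleton.elim (σ.comp _) (Rat.castHom (PadicAlgCl 2))] at h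

end

/-- For every integer `r ≥ 3` and every integer `d`, there exists a finite family `F` of
`r`-graphs whose Turán density `π(F) = lim_{n → ∞} ex(n, F) / C(n, r)` is an algebraic real
number whose minimal polynomial over `ℚ` has degree at least `d`. -/
theorem turan_density_large_algebraic_degree (r : ℕ) (hr : 3 ≤ r) (d : ℕ) :
    ∃ F : Finset ((a : ℕ) × Finset (Finset (Fin a))),
      (∀ G ∈ F, IsRGraph r G.1 G.2) ∧
      ∃ α : ℝ,
        Filter.Tendsto (fun n : ℕ => (exTuran r F n : ℝ) / (n.choose r : ℝ))
          Filter.atTop (nhds α) ∧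
        IsAlgebraic ℚ α ∧ d ≤ (minpoly ℚ α).natDegree := by
  obtain ⟨y, hy0, hys, hy⟩ := exists_seq_isLagrangian
  obtain ⟨j, rfl⟩ := Nat.exists_eq_add_of_le' hr
  obtain ⟨q, hq, hL⟩ := (hy d).exists_rat_mul j
  obtain ⟨F, hF, hlim⟩ := hL.exists_tendsto_exTuran
  have hα : ((j + 3).factorial : ℝ) * (q * (5 / 18 * (y d / (y d + 1) ^ 2))) =
      (((j + 3).factorial * q * (5 / 18) : ℚ) : ℝ) * (y d / (y d + 1) ^ 2) := by
    push_cast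
    ring
  rw [hα] at hlim
  obtain ⟨halg, hdeg⟩ := isAlgebraic_and_le_natDegree_of_seq hy0 hys
    (q := (j + 3).factorial * q * (5 / 18)) (by positivity) d
  exact ⟨F, hF, _, hlim, halg, (d.lt_succ_self.le.trans Nat.lt_two_pow_self.le).trans hdeg⟩
end

section
/- For every integer k ≥ 1 and every integer i with 0 ≤ i ≤ 2^k, the integer b_{k,i} is divisible by 3 if and only if i ≠ 2^k. -/
open Polynomial in
/-- `pp k` is the integer polynomial `p_{k+1}`: `pp 0 = p_1 = 3X² - 1`, and
`p_{k+2} = Σ_{i=0}^{2^{k+1}} c_{k+1,i} · (3X² - 1)^i · (2X²)^{2^{k+1} - i}`,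
where `c_{k+1,i}` is the coefficient of `X^i` in `p_{k+1} = pp k`. -/
noncomputable def pp : ℕ → Polynomial ℤ
  | 0 => 3 * X ^ 2 - 1
  | k + 1 => ∑ i ∈ Finset.range (2 ^ (k + 1) + 1),
      C ((pp k).coeff i) * (3 * X ^ 2 - 1) ^ i * (2 * X ^ 2) ^ (2 ^ (k + 1) - i)

/-- `bC k i` is the integer `b_{k,i}` (for `1 ≤ k`, `0 ≤ i ≤ 2^k`): `b_{k,i} = c_{k,i}`
for even `k` and `b_{k,i} = c_{k, 2^k - i}` for odd `k`, where `c_{k,i}` is the coefficient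
of `X^i` in `p_k = pp (k-1)`. -/
noncomputable def bC (k i : ℕ) : ℤ :=
  if Even k then (pp (k - 1)).coeff i else (pp (k - 1)).coeff (2 ^ k - i)

open Polynomial in
/-- Modulo `3`, the polynomials `pp k` are alternately `-1` and `-X ^ 2 ^ (k + 1)`. -/
theorem map_pp_zmod_three (k : ℕ) :
    (pp k).map (Int.castRingHom (ZMod 3)) = if Even k then -1 else -X ^ 2 ^ (k + 1) := by
  have h3 : (3 : (ZMod 3)[X]) = 0 := by exact_mod_cast CharP.cast_eq_zero (ZMod 3)[X] 3
  have h2 : (2 : (ZMod 3)[X]) = -1 := by linear_combination h3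
  have hpow (n : ℕ) : Even (2 ^ (n + 1)) := by simp [Nat.even_pow]
  induction k with
  | zero => simp [pp, h3]
  | succ k ih =>
    have hc (i : ℕ) : (C ((pp k).coeff i)).map (Int.castRingHom (ZMod 3)) =
        C ((if Even k then -1 else -X ^ 2 ^ (k + 1) : (ZMod 3)[X]).coeff i) := by
      rw [← ih, Polynomial.map_C, Polynomial.coeff_map]
    simp only [pp, Polynomial.map_sum, Polynomial.map_mul, Polynomial.map_pow, Polynomial.map_sub,
      Polynomial.map_ofNat, Polynomial.map_X, Polynomial.map_one, hc, h3, h2, zero_mul, zero_sub]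
    by_cases hk : Even k
    · rw [Finset.sum_eq_single 0]
      · have hk' : ¬ Even (k + 1) := by simp [Nat.even_add_one, hk]
        simp [hk, hk', (hpow k).neg_pow, ← pow_mul, pow_succ' 2 (k + 1)]
      · intro i _ hi
        simp [hk, coeff_one, hi]
      · simp
    · rw [Finset.sum_eq_single (2 ^ (k + 1))]
      · have hk' : Even (k + 1) := by simp [Nat.even_add_one, hk]
        simp [hk, hk', (hpow k).neg_pow]
      · intro i _ hi
        simp [hk, coeff_X_pow, hi]
      · simp

open Polynomial in
/-- The coefficient of `X ^ i` in `pp k` is a multiple of `3` unless it is the constant coefficient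
(`k` even) or the coefficient of `X ^ 2 ^ (k + 1)` (`k` odd). -/
theorem three_dvd_coeff_pp_iff (k i : ℕ) :
    (3 : ℤ) ∣ (pp k).coeff i ↔ i ≠ if Even k then 0 else 2 ^ (k + 1) := by
  have h : (((pp k).coeff i : ℤ) : ZMod 3) = ((pp k).map (Int.castRingHom (ZMod 3))).coeff i := by
    simp
  have hz := ZMod.intCast_zmod_eq_zero_iff_dvd ((pp k).coeff i) 3
  rw [Nat.cast_ofNat] at hz
  rw [← hz, h, map_pp_zmod_three]
  split_ifs
  · simp [coeff_one]
  · simp [coeff_X_pow]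

/-- For every integer `k ≥ 1` and every `0 ≤ i ≤ 2^k`, the integer `b_{k,i}` is divisible
by `3` if and only if `i ≠ 2^k`. -/
theorem three_dvd_bC_iff (k : ℕ) (hk : 1 ≤ k) (i : ℕ) (hi : i ≤ 2 ^ k) :
    (3 : ℤ) ∣ bC k i ↔ i ≠ 2 ^ k := by
  obtain ⟨k, rfl⟩ := Nat.exists_eq_add_of_le' hk
  by_cases h : Even k
  · have h' : ¬ Even (k + 1) := by simp [Nat.even_add_one, h]
    rw [bC, if_neg h', Nat.add_sub_cancel, three_dvd_coeff_pp_iff, if_pos h]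
    omega
  · have h' : Even (k + 1) := by simp [Nat.even_add_one, h]
    rw [bC, if_pos h', Nat.add_sub_cancel, three_dvd_coeff_pp_iff, if_neg h]
end

section
/- For every integer k ≥ 1, the integer b_{k,0} is not divisible by 9. -/
namespace Polynomial

theorem eval_homogenize_eq_sum {R : Type*} [CommSemiring R] (p : R[X]) (n : ℕ) (x y : R) :
    MvPolynomial.eval ![x, y] (p.homogenize n) =
      ∑ i ∈ Finset.range (n + 1), p.coeff i * x ^ i * y ^ (n - i) := by
  simp only [homogenize, Finset.Nat.sum_antidiagonal_eq_sum_range_succ_mk, MvPolynomial.eval_sum]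
  refine Finset.sum_congr rfl fun i _ ↦ ?_
  rw [MvPolynomial.eval_monomial, Finsupp.update_eq_add_single (by simp),
    Finsupp.prod_add_index' (by simp) (by simp [pow_add]),
    Finsupp.prod_single_index (by simp), Finsupp.prod_single_index (by simp)]
  simp [mul_assoc]

theorem eval_homogenize_one_zero {R : Type*} [CommSemiring R] (p : R[X]) (n : ℕ) :
    MvPolynomial.eval ![1, 0] (p.homogenize n) = p.coeff n := by
  rw [eval_homogenize_eq_sum, Finset.sum_range_succ, Finset.sum_eq_zero]
  · simp
  · intro i hi
    have : n - i ≠ 0 := by have := Finset.mem_range.1 hi; omega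
    simp [this]

theorem eval_homogenize_zero_one {R : Type*} [CommSemiring R] (p : R[X]) (n : ℕ) :
    MvPolynomial.eval ![0, 1] (p.homogenize n) = p.coeff 0 := by
  rw [eval_homogenize_eq_sum, Finset.sum_range_succ', Finset.sum_eq_zero]
  · simp
  · simp

theorem homogenize_pow {R : Type*} [CommSemiring R] {p : R[X]} {n : ℕ} (hp : p.natDegree ≤ n)
    (i : ℕ) : (p ^ i).homogenize (i * n) = p.homogenize n ^ i := by
  simpa using homogenize_finsetProd (s := Finset.range i) (p := fun _ ↦ p) (n := fun _ ↦ n)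
    fun _ _ ↦ hp

end Polynomial

open Polynomial in
/-- The value at `(x, y)` of the homogenization of `pp k` in degree `2 ^ (k + 1)`. -/
noncomputable def ppForm (k : ℕ) (x y : ℤ) : ℤ :=
  MvPolynomial.eval ![x, y] ((pp k).homogenize (2 ^ (k + 1)))

open Polynomial in
theorem eval_homogenize_three_mul_X_sq_sub_one (x y : ℤ) :
    MvPolynomial.eval ![x, y] ((3 * X ^ 2 - 1 : ℤ[X]).homogenize 2) = 3 * x ^ 2 - y ^ 2 := by
  rw [homogenize_sub, show (3 : ℤ[X]) = C 3 from rfl, homogenize_C_mul]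
  simp

open Polynomial in
theorem eval_homogenize_two_mul_X_sq (x y : ℤ) :
    MvPolynomial.eval ![x, y] ((2 * X ^ 2 : ℤ[X]).homogenize 2) = 2 * x ^ 2 := by
  rw [show (2 : ℤ[X]) = C 2 from rfl, homogenize_C_mul]
  simp

theorem ppForm_zero (x y : ℤ) : ppForm 0 x y = 3 * x ^ 2 - y ^ 2 :=
  eval_homogenize_three_mul_X_sq_sub_one x y

open Polynomial in
theorem ppForm_succ (k : ℕ) (x y : ℤ) :
    ppForm (k + 1) x y = ppForm k (3 * x ^ 2 - y ^ 2) (2 * x ^ 2) := by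
  have hp : (3 * X ^ 2 - 1 : ℤ[X]).natDegree ≤ 2 := by compute_degree
  have hq : (2 * X ^ 2 : ℤ[X]).natDegree ≤ 2 := by compute_degree
  rw [ppForm, ppForm, eval_homogenize_eq_sum (pp k), pp, homogenize_finsetSum, map_sum]
  refine Finset.sum_congr rfl fun i hi ↦ ?_
  have hdeg : 2 ^ (k + 1 + 1) = i * 2 + (2 ^ (k + 1) - i) * 2 := by
    have := Finset.mem_range.1 hi
    rw [pow_succ]
    omega
  rw [mul_assoc, homogenize_C_mul, hdeg,
    homogenize_mul _ _ (natDegree_pow_le_of_le i hp) (natDegree_pow_le_of_le _ hq),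
    homogenize_pow hp, homogenize_pow hq, map_mul, map_mul, map_pow, map_pow,
    eval_homogenize_three_mul_X_sq_sub_one, eval_homogenize_two_mul_X_sq, MvPolynomial.eval_C,
    mul_assoc]

theorem nine_not_dvd_ppForm_two_mul (m : ℕ) {x y : ℤ} (hx : ¬ 3 ∣ x) (hy : 9 ∣ y) :
    ¬ 9 ∣ ppForm (2 * m) x y := by
  obtain ⟨b, rfl⟩ := hy
  induction m generalizing x b with
  | zero =>
    rw [mul_zero, ppForm_zero]
    exact fun h ↦ hx (Int.prime_three.dvd_of_dvd_pow (n := 2) (by ring_nf at h ⊢; omega))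
  | succ m ih =>
    rw [mul_add_one, ppForm_succ, ppForm_succ,
      show 2 * (3 * x ^ 2 - (9 * b) ^ 2) ^ 2 = 9 * (2 * (x ^ 2 - 27 * b ^ 2) ^ 2) by ring]
    refine ih (fun h ↦ hx (Int.prime_three.dvd_of_dvd_pow (n := 4) ?_)) _
    ring_nf at h ⊢
    omega

/-- For every integer `k ≥ 1`, the integer `b_{k,0}` is not divisible by `9`. -/
theorem nine_not_dvd_bC_zero (k : ℕ) (hk : 1 ≤ k) : ¬ (9 : ℤ) ∣ bC k 0 := by
  obtain ⟨m, rfl⟩ | ⟨m, rfl⟩ := k.even_or_odd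
  · obtain ⟨n, rfl⟩ : ∃ n, m = n + 1 := ⟨m - 1, by omega⟩
    rw [bC, if_pos (by simp), show n + 1 + (n + 1) - 1 = 2 * n + 1 by omega,
      ← Polynomial.eval_homogenize_zero_one _ (2 ^ (2 * n + 1 + 1)), ← ppForm, ppForm_succ]
    exact nine_not_dvd_ppForm_two_mul n (by norm_num) (by norm_num)
  · rw [bC, if_neg (by simp), Nat.add_sub_cancel, Nat.sub_zero,
      ← Polynomial.eval_homogenize_one_zero, ← ppForm]
    exact nine_not_dvd_ppForm_two_mul m (by norm_num) (by norm_num)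
end

section
/- For every integer k ≥ 1, the polynomial p_k has degree exactly 2^k and is irreducible over ℚ. -/
open Polynomial in
/-- The homogeneous substitution `B ^ n * p (A / B)`, for `p` of degree at most `n`. -/
noncomputable def homSubst (n : ℕ) (p A B : ℤ[X]) : ℤ[X] :=
  ∑ i ∈ Finset.range (n + 1), C (p.coeff i) * A ^ i * B ^ (n - i)

open Polynomial in
lemma aeval_homSubst {K : Type*} [Field K] {n : ℕ} {p : ℤ[X]} (hp : p.natDegree ≤ n)
    (A B : ℤ[X]) {x : K} (hB : aeval x B ≠ 0) :
    aeval x (homSubst n p A B) = aeval x B ^ n * aeval (aeval x A / aeval x B) p := by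
  rw [aeval_eq_sum_range' (Nat.lt_succ_of_le hp), homSubst, map_sum, Finset.mul_sum]
  refine Finset.sum_congr rfl fun i hi => ?_
  have hi' : i ≤ n := Nat.lt_succ_iff.mp (Finset.mem_range.mp hi)
  obtain ⟨j, rfl⟩ := Nat.exists_eq_add_of_le hi'
  simp only [map_mul, map_pow, eq_intCast, map_intCast, Nat.add_sub_cancel_left, zsmul_eq_mul,
    div_pow, pow_add]
  field_simp

open Polynomial in
lemma aeval_homSubst_of_eq_zero {K : Type*} [Field K] (n : ℕ) (p A B : ℤ[X]) {x : K}
    (hB : aeval x B = 0) :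
    aeval x (homSubst n p A B) = p.coeff n * aeval x A ^ n := by
  rw [homSubst, map_sum, Finset.sum_eq_single n]
  · simp
  · intro i hi hin
    have : n - i ≠ 0 := by have := Finset.mem_range.mp hi; omega
    simp [hB, this]
  · simp

open Polynomial in
lemma natDegree_homSubst_le {A B : ℤ[X]} {d : ℕ} (hA : A.natDegree ≤ d) (hB : B.natDegree ≤ d)
    (n : ℕ) (p : ℤ[X]) : (homSubst n p A B).natDegree ≤ n * d := by
  refine natDegree_sum_le_of_forall_le _ _ fun i hi => ?_
  have hi' : i + (n - i) = n := by have := Finset.mem_range.mp hi; omega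
  rw [mul_assoc]
  refine (natDegree_C_mul_le _ _).trans ?_
  calc (A ^ i * B ^ (n - i)).natDegree ≤ i * d + (n - i) * d :=
        natDegree_mul_le_of_le (natDegree_pow_le_of_le i hA) (natDegree_pow_le_of_le _ hB)
    _ = n * d := by rw [← add_mul, hi']

open Polynomial in
lemma coeff_homSubst {A B : ℤ[X]} {d : ℕ} (hA : A.natDegree ≤ d) (hB : B.natDegree ≤ d)
    (n : ℕ) (p : ℤ[X]) : (homSubst n p A B).coeff (n * d) =
      ∑ i ∈ Finset.range (n + 1), p.coeff i * (A.coeff d ^ i * B.coeff d ^ (n - i)) := by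
  rw [homSubst, finsetSum_coeff]
  refine Finset.sum_congr rfl fun i hi => ?_
  have hi' : i + (n - i) = n := by have := Finset.mem_range.mp hi; omega
  have hn : n * d = i * d + (n - i) * d := by rw [← add_mul, hi']
  rw [mul_assoc, coeff_C_mul, hn, coeff_mul_add_eq_of_natDegree_le
    (natDegree_pow_le_of_le i hA) (natDegree_pow_le_of_le _ hB),
    coeff_pow_of_natDegree_le hA, coeff_pow_of_natDegree_le hB]

open Polynomial in
lemma pp_succ (k : ℕ) :
    pp (k + 1) = homSubst (2 ^ (k + 1)) (pp k) (3 * X ^ 2 - 1) (2 * X ^ 2) := rfl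

open Polynomial in
lemma natDegree_pp_le (k : ℕ) : (pp k).natDegree ≤ 2 ^ (k + 1) := by
  cases k with
  | zero => rw [pp]; compute_degree!
  | succ k =>
    rw [pp_succ, pow_succ 2 (k + 1)]
    exact natDegree_homSubst_le (by compute_degree!) (by compute_degree!) _ _

open Polynomial in
lemma odd_coeff_pp (k : ℕ) : Odd ((pp k).coeff (2 ^ (k + 1))) := by
  induction k with
  | zero =>
    have : (pp 0).coeff (2 ^ (0 + 1)) = 3 := by rw [pp]; compute_degree!
    rw [this]; decide
  | succ k ih =>
    have hA : (3 * X ^ 2 - 1 : ℤ[X]).coeff 2 = 3 := by compute_degree!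
    have hB : (2 * X ^ 2 : ℤ[X]).coeff 2 = 2 := by compute_degree!
    rw [pp_succ, pow_succ 2 (k + 1),
      coeff_homSubst (by compute_degree!) (by compute_degree!), hA, hB, Finset.sum_range_succ]
    refine Even.add_odd (Finset.even_sum _ fun i hi => ?_) ?_
    · have : 2 ^ (k + 1) - i ≠ 0 := by have := Finset.mem_range.mp hi; omega
      exact ((even_two.pow_of_ne_zero this).mul_left _).mul_left _
    · rw [Nat.sub_self, pow_zero, mul_one]
      exact ih.mul (Odd.pow (by decide))

lemma coeff_pp_ne_zero (k : ℕ) : (pp k).coeff (2 ^ (k + 1)) ≠ 0 := fun h => by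
  simpa [h] using odd_coeff_pp k

lemma natDegree_pp (k : ℕ) : (pp k).natDegree = 2 ^ (k + 1) :=
  le_antisymm (natDegree_pp_le k) (Polynomial.le_natDegree_of_ne_zero (coeff_pp_ne_zero k))

open Polynomial in
/-- The iterates of `s ↦ (s + 2) ^ 2 / (s + 1)`, which is the map `x ↦ (3 x ^ 2 - 1) / (2 x ^ 2)`
in the coordinate `s = 2 / (x - 1)`: the roots of `qq k` are the points reaching `-2`, that is
`x = 0`, after `k + 1` steps. -/
noncomputable def qq : ℕ → ℤ[X]
  | 0 => X ^ 2 + 6 * X + 6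
  | k + 1 => homSubst (2 ^ (k + 1)) (qq k) ((X + 2) ^ 2) (X + 1)

open Polynomial in
lemma natDegree_qq_le (k : ℕ) : (qq k).natDegree ≤ 2 ^ (k + 1) := by
  cases k with
  | zero => rw [qq]; compute_degree!
  | succ k =>
    rw [qq, pow_succ 2 (k + 1)]
    exact natDegree_homSubst_le (by compute_degree!) (by compute_degree!) _ _

open Polynomial in
lemma coeff_qq (k : ℕ) : (qq k).coeff (2 ^ (k + 1)) = 1 := by
  induction k with
  | zero => rw [qq]; compute_degree!
  | succ k ih =>
    have hA : ((X + 2) ^ 2 : ℤ[X]).coeff 2 = 1 := by compute_degree!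
    have hB : (X + 1 : ℤ[X]).coeff 2 = 0 := by compute_degree!
    rw [qq, pow_succ 2 (k + 1), coeff_homSubst (by compute_degree!) (by compute_degree!), hA, hB,
      Finset.sum_range_succ, Finset.sum_eq_zero]
    · simp [ih]
    · intro i hi
      have : 2 ^ (k + 1) - i ≠ 0 := by have := Finset.mem_range.mp hi; omega
      simp [this]

lemma monic_qq (k : ℕ) : (qq k).Monic :=
  Polynomial.monic_of_natDegree_le_of_coeff_eq_one _ (natDegree_qq_le k) (coeff_qq k)

lemma natDegree_qq (k : ℕ) : (qq k).natDegree = 2 ^ (k + 1) :=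
  le_antisymm (natDegree_qq_le k)
    (Polynomial.le_natDegree_of_ne_zero (by rw [coeff_qq]; exact one_ne_zero))

open Polynomial in
lemma map_qq (k : ℕ) : (qq k).map (Int.castRingHom (ZMod 2)) = X ^ 2 ^ (k + 1) := by
  have h2 : (2 : (ZMod 2)[X]) = 0 := CharTwo.two_eq_zero
  induction k with
  | zero =>
    have h6 : (6 : (ZMod 2)[X]) = 0 := by linear_combination 3 * h2
    simp [qq, h6]
  | succ k ih =>
    have hc (i : ℕ) : Int.castRingHom (ZMod 2) ((qq k).coeff i) = if i = 2 ^ (k + 1) then 1 else 0 := by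
      rw [← coeff_X_pow, ← ih, coeff_map]
    rw [qq, homSubst, Polynomial.map_sum, Finset.sum_eq_single (2 ^ (k + 1))]
    · simp only [Polynomial.map_mul, Polynomial.map_pow, map_C, hc]
      simp [h2, ← pow_mul, pow_succ' 2 (k + 1)]
    · intro i _ hi
      simp only [Polynomial.map_mul, map_C, hc, hi, if_false, map_zero, zero_mul]
    · simp

open Polynomial in
lemma eval_zero_qq (k : ℕ) : (qq k).eval 0 ≡ 2 [ZMOD 4] := by
  induction k with
  | zero => simp [qq, Int.ModEq]
  | succ k ih =>
    have h : (qq (k + 1)).eval 0 = (qq k).eval 4 := by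
      rw [qq, homSubst, eval_finsetSum,
        eval_eq_sum_range' (Nat.lt_succ_of_le (natDegree_qq_le k))]
      norm_num
    rw [h]
    refine Int.ModEq.trans (Int.ModEq.symm ?_) ih
    simpa [Int.modEq_iff_dvd] using sub_dvd_eval_sub 4 0 (qq k)

open Polynomial in
lemma isEisensteinAt_qq (k : ℕ) : (qq k).IsEisensteinAt (Ideal.span {2}) where
  leading := by
    rw [(monic_qq k).leadingCoeff, Ideal.mem_span_singleton]; decide
  mem {i} hi := by
    rw [natDegree_qq] at hi
    have h := congrArg (coeff · i) (map_qq k)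
    simp only [coeff_map, coeff_X_pow, hi.ne, if_false, eq_intCast] at h
    rw [Ideal.mem_span_singleton]
    exact (ZMod.intCast_zmod_eq_zero_iff_dvd _ 2).mp h
  notMem := by
    rw [Ideal.span_singleton_pow, Ideal.mem_span_singleton, coeff_zero_eq_eval_zero]
    have := eval_zero_qq k
    rw [Int.ModEq] at this
    omega

lemma irreducible_qq (k : ℕ) : Irreducible (qq k) :=
  (isEisensteinAt_qq k).irreducible
    ((Ideal.span_singleton_prime two_ne_zero).mpr Int.prime_two) (monic_qq k).isPrimitive
    (by rw [natDegree_qq]; positivity)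

open Polynomial in
lemma aeval_qq_of_aeval_pp {K : Type*} [Field K] [CharZero K] (k : ℕ) {x : K}
    (hx : aeval x (pp k) = 0) : x ≠ 1 ∧ aeval (2 / (x - 1)) (qq k) = 0 := by
  induction k generalizing x with
  | zero =>
    simp only [pp, map_sub, map_mul, map_pow, aeval_X, map_ofNat, map_one] at hx
    have h1 : x ≠ 1 := by rintro rfl; norm_num at hx
    have h1' := sub_ne_zero.mpr h1
    refine ⟨h1, ?_⟩
    simp only [qq, map_add, map_mul, map_pow, aeval_X, map_ofNat]
    field_simp
    linear_combination 2 * hx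
  | succ k ih =>
    have hA : aeval x (3 * X ^ 2 - 1 : ℤ[X]) = 3 * x ^ 2 - 1 := by simp [map_ofNat]
    have hB : aeval x (2 * X ^ 2 : ℤ[X]) = 2 * x ^ 2 := by simp [map_ofNat]
    rw [pp_succ] at hx
    have h0 : x ≠ 0 := by
      rintro rfl
      rw [aeval_homSubst_of_eq_zero _ _ _ _ (by simp), hA] at hx
      simp [coeff_pp_ne_zero k] at hx
    have hB0 : 2 * x ^ 2 ≠ 0 := mul_ne_zero two_ne_zero (pow_ne_zero 2 h0)
    rw [aeval_homSubst (natDegree_pp_le k) _ _ (hB ▸ hB0), hA, hB] at hx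
    obtain ⟨hf, hq⟩ := ih ((mul_eq_zero.mp hx).resolve_left (pow_ne_zero _ hB0))
    have h1 : x ≠ 1 := by rintro rfl; norm_num at hf
    have hm1 : x + 1 ≠ 0 := fun h => by
      rw [eq_neg_of_add_eq_zero_left h] at hf; norm_num at hf
    have h1' := sub_ne_zero.mpr h1
    refine ⟨h1, ?_⟩
    have hC : aeval (2 / (x - 1)) (X + 1 : ℤ[X]) = (x + 1) / (x - 1) := by
      simp only [map_add, aeval_X, map_one]; field_simp; ring
    have hD : aeval (2 / (x - 1)) ((X + 2) ^ 2 : ℤ[X]) = (2 * x / (x - 1)) ^ 2 := by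
      simp only [map_add, map_pow, aeval_X, map_ofNat]; field_simp; ring
    rw [qq, aeval_homSubst (natDegree_qq_le k) _ _ (hC ▸ div_ne_zero hm1 h1'), hC, hD]
    have hg : (2 * x / (x - 1)) ^ 2 / ((x + 1) / (x - 1)) =
        2 / ((3 * x ^ 2 - 1) / (2 * x ^ 2) - 1) := by
      have h : (3 * x ^ 2 - 1) / (2 * x ^ 2) - 1 = (x - 1) * (x + 1) / (2 * x ^ 2) := by
        field_simp; ring
      rw [h]; field_simp
    rw [hg, hq, mul_zero]

open Polynomial IntermediateField in
lemma irreducible_of_aeval_mem_adjoin {F L : Type*} [Field F] [Field L] [Algebra F L]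
    {p q : F[X]} {x s : L} (hp : p ≠ 0) (hx : aeval x p = 0) (hq : Irreducible q)
    (hs : aeval s q = 0) (hsx : s ∈ F⟮x⟯) (hdeg : p.natDegree ≤ q.natDegree) :
    Irreducible p := by
  have hxint : IsIntegral F x := IsAlgebraic.isIntegral ⟨p, hp, hx⟩
  have hsint : IsIntegral F s := IsAlgebraic.isIntegral ⟨q, hq.ne_zero, hs⟩
  have := adjoin.finiteDimensional hxint
  have hle : (minpoly F s).natDegree ≤ (minpoly F x).natDegree := by
    rw [← adjoin.finrank hxint, ← adjoin.finrank hsint]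
    exact finrank_le_of_le_right (adjoin_simple_le_iff.mpr hsx)
  have hqs : (minpoly F s).natDegree = q.natDegree :=
    natDegree_eq_of_degree_eq (degree_eq_degree_of_associated
      ((minpoly.irreducible hsint).associated_of_dvd hq (minpoly.dvd F s hs)))
  refine (associated_of_dvd_of_natDegree_le (minpoly.dvd F x hx) hp ?_).irreducible
    (minpoly.irreducible hxint)
  omega

/-- For every integer `k ≥ 1`, the polynomial `p_k = pp (k-1)` has degree exactly `2^k`
and is irreducible over `ℚ`. -/
theorem pp_degree_irreducible (k : ℕ) (hk : 1 ≤ k) :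
    (pp (k - 1)).natDegree = 2 ^ k ∧
    Irreducible ((pp (k - 1)).map (Int.castRingHom ℚ)) := by
  obtain ⟨k, rfl⟩ := Nat.exists_eq_add_of_le' hk
  rw [Nat.add_sub_cancel]
  refine ⟨natDegree_pp k, ?_⟩
  have hinj : Function.Injective (Int.castRingHom ℚ) := Int.cast_injective
  have hdeg : ((pp k).map (Int.castRingHom ℚ)).natDegree = 2 ^ (k + 1) := by
    rw [Polynomial.natDegree_map_eq_of_injective hinj, natDegree_pp]
  have hpos : 0 < ((pp k).map (Int.castRingHom ℚ)).natDegree := by rw [hdeg]; positivity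
  obtain ⟨x, hx⟩ := IsAlgClosed.exists_aeval_eq_zero ℂ ((pp k).map (Int.castRingHom ℚ))
    (Polynomial.natDegree_pos_iff_degree_pos.mp hpos).ne'
  have hx' : Polynomial.aeval x (pp k) = 0 := by
    rwa [← algebraMap_int_eq, Polynomial.aeval_map_algebraMap] at hx
  obtain ⟨-, hs⟩ := aeval_qq_of_aeval_pp k hx'
  have hq : Irreducible ((qq k).map (Int.castRingHom ℚ)) :=
    (Polynomial.IsPrimitive.Int.irreducible_iff_irreducible_map_cast (monic_qq k).isPrimitive).mp
      (irreducible_qq k)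
  refine irreducible_of_aeval_mem_adjoin (Polynomial.ne_zero_of_natDegree_gt hpos) hx hq
    (s := 2 / (x - 1)) ?_ ?_ ?_
  · rwa [← algebraMap_int_eq, Polynomial.aeval_map_algebraMap]
  · exact div_mem (ofNat_mem _ 2) (sub_mem (IntermediateField.mem_adjoin_simple_self ℚ x)
      (one_mem _))
  · rw [hdeg, Polynomial.natDegree_map_eq_of_injective hinj, natDegree_qq]
end
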